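/- arXiv:1410.6491 — 2 statements merged into one kernel-verified Lean document; each statement's English description precedes it below -/
import Mathlib

section
/- (Lemma 2.1 for the SABRA model) For any real numbers α₁, α₂, α₃ with α₁ + α₂ + α₃ ≥ 1/2 there exists a constant c > 0, depending only on α₁, α₂, α₃, a, b, k₀ and λ, such that for every u ∈ V_{α₁} and v ∈ V_{α₂} the sequence B(u,v) belongs to V_{−α₃} and Σ_{n=1}^∞ k_n^{−4α₃} |b_n(u,v)|² ≤ c² (Σ_{n=1}^∞ k_n^{4α₁}|u_n|²) (Σ_{n=1}^∞ k_n^{4α₂}|v_n|²); that is, ‖B(u,v)‖_{V_{−α₃}} ≤ c ‖u‖_{V_{α₁}} ‖v‖_{V_{α₂}}. -/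
open scoped ComplexConjugate

/-- The wavenumbers `k_n = k₀ λ^n`. -/
noncomputable def kk (k0 lam : ℝ) (n : ℕ) : ℝ := k0 * lam ^ n

/-- Extension of a sequence (meaningful for indices `n ≥ 1`) by zero at index `0`,
realizing the convention `u₀ = u₋₁ = 0` (natural subtraction sends `-1` to `0`). -/
def sh (u : ℕ → ℂ) (n : ℕ) : ℂ := if n = 0 then 0 else u n

/-- The SABRA shell-model nonlinearity `b_n(u,v)`, for `n ≥ 1`. -/
noncomputable def bSAB (a b k0 lam : ℝ) (u v : ℕ → ℂ) (n : ℕ) : ℂ :=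
  - Complex.I * ((a : ℂ) * (kk k0 lam (n+1) : ℝ) * conj (sh u (n+1)) * sh v (n+2)
    + (b : ℂ) * (kk k0 lam n : ℝ) * conj (sh u (n-1)) * sh v (n+1)
    + (a : ℂ) * (kk k0 lam (n-1) : ℝ) * sh u (n-1) * sh v (n-2)
    + (b : ℂ) * (kk k0 lam (n-1) : ℝ) * sh u (n-2) * sh v (n-1))

/-- `B(u,v) = -(b₁(u,v), b₂(u,v), …)` for the SABRA model. -/
noncomputable def BSAB (a b k0 lam : ℝ) (u v : ℕ → ℂ) (n : ℕ) : ℂ := - bSAB a b k0 lam u v n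

lemma kk_pos {k0 lam : ℝ} (hk0 : 0 < k0) (hlam : 1 < lam) (n : ℕ) : 0 < kk k0 lam n :=
  mul_pos hk0 (pow_pos (by linarith) n)

lemma kk_le_sq_mul {k0 lam : ℝ} (hk0 : 0 < k0) (hlam : 1 < lam) {m n : ℕ} (h : m ≤ n + 2) :
    kk k0 lam m ≤ lam ^ (2 : ℝ) * kk k0 lam n := by
  have h1 : lam ^ m ≤ lam ^ (n + 2) := pow_le_pow_right₀ hlam.le h
  have h2 := mul_le_mul_of_nonneg_left h1 hk0.le
  rw [Real.rpow_two]
  unfold kk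
  calc _ ≤ _ := h2
    _ = _ := by ring

lemma kk_rpow_le {k0 lam : ℝ} (hk0 : 0 < k0) (hlam : 1 < lam) {m n : ℕ} (h : m ≤ n + 2)
    (h' : n ≤ m + 2) (s : ℝ) :
    kk k0 lam m ^ s ≤ lam ^ (2 * |s|) * kk k0 lam n ^ s := by
  have hl : 0 < lam := by linarith
  have hm := kk_pos hk0 hlam m
  have hn := kk_pos hk0 hlam n
  rcases le_total 0 s with hs | hs
  · rw [abs_of_nonneg hs, Real.rpow_mul hl.le, ← Real.mul_rpow (by positivity) hn.le]
    exact Real.rpow_le_rpow hm.le (kk_le_sq_mul hk0 hlam h) hs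
  · have h1 := Real.rpow_le_rpow_of_nonpos hn (kk_le_sq_mul hk0 hlam h') hs
    rw [Real.mul_rpow (by positivity) hm.le, ← Real.rpow_mul hl.le] at h1
    have h2 := mul_le_mul_of_nonneg_left h1 (Real.rpow_nonneg hl.le (2 * |s|))
    rwa [← mul_assoc, ← Real.rpow_add hl, abs_of_nonpos hs,
      show 2 * -s + 2 * s = 0 by ring, Real.rpow_zero, one_mul, ← abs_of_nonpos hs] at h2

/-- The constant bounding the weights in a single term of the nonlinearity. -/
noncomputable def weightConst (k0 lam α₁ α₂ α₃ : ℝ) : ℝ :=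
  lam ^ (2 * |(2 : ℝ)|) * lam ^ (2 * |4 * α₁|) * lam ^ (2 * |4 * α₂|)
    * k0 ^ (2 - 4 * (α₁ + α₂ + α₃))

lemma weightConst_pos {k0 lam : ℝ} (hk0 : 0 < k0) (hlam : 1 < lam) (α₁ α₂ α₃ : ℝ) :
    0 < weightConst k0 lam α₁ α₂ α₃ := by
  have hl : 0 < lam := by linarith
  unfold weightConst
  positivity

lemma weight_le {k0 lam : ℝ} (hk0 : 0 < k0) (hlam : 1 < lam) {α₁ α₂ α₃ : ℝ}
    (hα : (1 : ℝ) / 2 ≤ α₁ + α₂ + α₃) {n l i j : ℕ} (hl : l ≤ n + 2 ∧ n ≤ l + 2)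
    (hi : i ≤ n + 2 ∧ n ≤ i + 2) (hj : j ≤ n + 2 ∧ n ≤ j + 2) :
    kk k0 lam n ^ (4 * (-α₃)) * kk k0 lam l ^ 2 ≤
      weightConst k0 lam α₁ α₂ α₃ * (kk k0 lam i ^ (4 * α₁) * kk k0 lam j ^ (4 * α₂)) := by
  have hlp : 0 < lam := by linarith
  have hn := kk_pos hk0 hlam n
  have hi0 := kk_pos hk0 hlam i
  have hj0 := kk_pos hk0 hlam j
  have hl0 := kk_pos hk0 hlam l
  have e1 := kk_rpow_le hk0 hlam hl.1 hl.2 2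
  have e2 := kk_rpow_le hk0 hlam hi.2 hi.1 (4 * α₁)
  have e3 := kk_rpow_le hk0 hlam hj.2 hj.1 (4 * α₂)
  have hkn : k0 ≤ kk k0 lam n := le_mul_of_one_le_right hk0.le (one_le_pow₀ hlam.le)
  have e4 : kk k0 lam n ^ (2 - 4 * (α₁ + α₂ + α₃)) ≤ k0 ^ (2 - 4 * (α₁ + α₂ + α₃)) :=
    Real.rpow_le_rpow_of_nonpos hk0 hkn (by linarith)
  unfold weightConst
  rw [← Real.rpow_two (kk k0 lam l)]
  calc kk k0 lam n ^ (4 * (-α₃)) * kk k0 lam l ^ (2 : ℝ)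
      ≤ kk k0 lam n ^ (4 * (-α₃)) * (lam ^ (2 * |(2 : ℝ)|) * kk k0 lam n ^ (2 : ℝ)) := by gcongr
    _ = lam ^ (2 * |(2 : ℝ)|) * (kk k0 lam n ^ (2 - 4 * (α₁ + α₂ + α₃)) *
          (kk k0 lam n ^ (4 * α₁) * kk k0 lam n ^ (4 * α₂))) := by
        rw [← Real.rpow_add hn, ← Real.rpow_add hn, mul_left_comm, ← Real.rpow_add hn]
        congr 2
        ring
    _ ≤ lam ^ (2 * |(2 : ℝ)|) * (k0 ^ (2 - 4 * (α₁ + α₂ + α₃)) *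
          ((lam ^ (2 * |4 * α₁|) * kk k0 lam i ^ (4 * α₁)) *
            (lam ^ (2 * |4 * α₂|) * kk k0 lam j ^ (4 * α₂)))) := by gcongr
    _ = _ := by ring

/-- The term of index `n` of the square of the `V_α` norm, with value `0` at `n = 0`. -/
noncomputable def energyTerm (k0 lam α : ℝ) (u : ℕ → ℂ) (n : ℕ) : ℝ :=
  kk k0 lam n ^ (4 * α) * ‖sh u n‖ ^ 2

lemma energyTerm_zero (k0 lam α : ℝ) (u : ℕ → ℂ) : energyTerm k0 lam α u 0 = 0 := by
  simp [energyTerm, sh]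

lemma energyTerm_nonneg {k0 lam : ℝ} (hk0 : 0 < k0) (hlam : 1 < lam) (α : ℝ) (u : ℕ → ℂ)
    (n : ℕ) : 0 ≤ energyTerm k0 lam α u n :=
  mul_nonneg (Real.rpow_nonneg (kk_pos hk0 hlam n).le _) (sq_nonneg _)

lemma term_le {k0 lam : ℝ} (hk0 : 0 < k0) (hlam : 1 < lam) {α₁ α₂ α₃ : ℝ}
    (hα : (1 : ℝ) / 2 ≤ α₁ + α₂ + α₃) (a : ℝ) (u v : ℕ → ℂ) {U : ℝ}
    (hU : ∀ n, energyTerm k0 lam α₁ u n ≤ U) {n l i j : ℕ} (hl : l ≤ n + 2 ∧ n ≤ l + 2)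
    (hi : i ≤ n + 2 ∧ n ≤ i + 2) (hj : j ≤ n + 2 ∧ n ≤ j + 2) :
    kk k0 lam n ^ (4 * (-α₃)) * (|a| * kk k0 lam l * ‖sh u i‖ * ‖sh v j‖) ^ 2 ≤
      a ^ 2 * weightConst k0 lam α₁ α₂ α₃ * U * energyTerm k0 lam α₂ v j := by
  have h := weight_le hk0 hlam hα hl hi hj
  have hw := weightConst_pos hk0 hlam α₁ α₂ α₃
  have hV := energyTerm_nonneg hk0 hlam α₂ v j
  calc kk k0 lam n ^ (4 * (-α₃)) * (|a| * kk k0 lam l * ‖sh u i‖ * ‖sh v j‖) ^ 2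
      = (kk k0 lam n ^ (4 * (-α₃)) * kk k0 lam l ^ 2) *
          (a ^ 2 * ‖sh u i‖ ^ 2 * ‖sh v j‖ ^ 2) := by
        rw [← sq_abs a]; ring
    _ ≤ (weightConst k0 lam α₁ α₂ α₃ * (kk k0 lam i ^ (4 * α₁) * kk k0 lam j ^ (4 * α₂))) *
          (a ^ 2 * ‖sh u i‖ ^ 2 * ‖sh v j‖ ^ 2) := by gcongr
    _ = a ^ 2 * weightConst k0 lam α₁ α₂ α₃ * energyTerm k0 lam α₁ u i *
          energyTerm k0 lam α₂ v j := by unfold energyTerm; ring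
    _ ≤ _ := by gcongr; exact hU i

lemma norm_BSAB_le {k0 lam : ℝ} (hk0 : 0 < k0) (hlam : 1 < lam) (a b : ℝ) (u v : ℕ → ℂ)
    (n : ℕ) :
    ‖BSAB a b k0 lam u v n‖ ≤
      |a| * kk k0 lam (n + 1) * ‖sh u (n + 1)‖ * ‖sh v (n + 2)‖
      + |b| * kk k0 lam n * ‖sh u (n - 1)‖ * ‖sh v (n + 1)‖
      + |a| * kk k0 lam (n - 1) * ‖sh u (n - 1)‖ * ‖sh v (n - 2)‖
      + |b| * kk k0 lam (n - 1) * ‖sh u (n - 2)‖ * ‖sh v (n - 1)‖ := by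
  unfold BSAB bSAB
  rw [norm_neg, norm_mul, norm_neg, Complex.norm_I, one_mul]
  refine norm_add₄_le.trans_eq ?_
  simp only [norm_mul, Complex.norm_real, RCLike.norm_conj, Real.norm_eq_abs,
    abs_of_pos (kk_pos hk0 hlam _)]

lemma add_four_sq_le (x y z w : ℝ) :
    (x + y + z + w) ^ 2 ≤ 4 * (x ^ 2 + y ^ 2 + z ^ 2 + w ^ 2) := by
  nlinarith [sq_nonneg (x - y), sq_nonneg (x - z), sq_nonneg (x - w), sq_nonneg (y - z),
    sq_nonneg (y - w), sq_nonneg (z - w)]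

lemma BSAB_term_le {k0 lam : ℝ} (hk0 : 0 < k0) (hlam : 1 < lam) {α₁ α₂ α₃ : ℝ}
    (hα : (1 : ℝ) / 2 ≤ α₁ + α₂ + α₃) (a b : ℝ) (u v : ℕ → ℂ) {U : ℝ}
    (hU : ∀ n, energyTerm k0 lam α₁ u n ≤ U) (n : ℕ) :
    kk k0 lam (n + 1) ^ (4 * (-α₃)) * ‖BSAB a b k0 lam u v (n + 1)‖ ^ 2 ≤
      4 * (a ^ 2 + b ^ 2 + 1) * weightConst k0 lam α₁ α₂ α₃ * U *
        (energyTerm k0 lam α₂ v (n + 3) + energyTerm k0 lam α₂ v (n + 2)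
          + energyTerm k0 lam α₂ v (n - 1) + energyTerm k0 lam α₂ v n) := by
  have hw := weightConst_pos hk0 hlam α₁ α₂ α₃
  have hU0 : 0 ≤ U := (energyTerm_nonneg hk0 hlam α₁ u 0).trans (hU 0)
  have hV := energyTerm_nonneg hk0 hlam α₂ v
  have hk := Real.rpow_nonneg (kk_pos hk0 hlam (n + 1)).le (4 * (-α₃))
  have hB := norm_BSAB_le hk0 hlam a b u v (n + 1)
  simp only [show n + 1 + 1 = n + 2 by lia, show n + 1 + 2 = n + 3 by lia,
    show n + 1 - 1 = n by lia, show n + 1 - 2 = n - 1 by lia] at hB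
  have t1 := term_le hk0 hlam hα a u v hU (n := n + 1) (l := n + 2) (i := n + 2) (j := n + 3)
    (by lia) (by lia) (by lia)
  have t2 := term_le hk0 hlam hα b u v hU (n := n + 1) (l := n + 1) (i := n) (j := n + 2)
    (by lia) (by lia) (by lia)
  have t3 := term_le hk0 hlam hα a u v hU (n := n + 1) (l := n) (i := n) (j := n - 1)
    (by lia) (by lia) (by lia)
  have t4 := term_le hk0 hlam hα b u v hU (n := n + 1) (l := n) (i := n - 1) (j := n)
    (by lia) (by lia) (by lia)
  have ha : a ^ 2 ≤ a ^ 2 + b ^ 2 + 1 := by nlinarith [sq_nonneg b]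
  have hb : b ^ 2 ≤ a ^ 2 + b ^ 2 + 1 := by nlinarith [sq_nonneg a]
  have coeff {r s y : ℝ} (hrs : r ≤ s) (hy : 0 ≤ y) :
      r * weightConst k0 lam α₁ α₂ α₃ * U * y ≤ s * weightConst k0 lam α₁ α₂ α₃ * U * y := by
    gcongr
  have s1 := t1.trans (coeff ha (hV (n + 3)))
  have s2 := t2.trans (coeff hb (hV (n + 2)))
  have s3 := t3.trans (coeff ha (hV (n - 1)))
  have s4 := t4.trans (coeff hb (hV n))
  have hsq := (pow_le_pow_left₀ (norm_nonneg _) hB 2).trans (add_four_sq_le _ _ _ _)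
  refine (mul_le_mul_of_nonneg_left hsq hk).trans ?_
  linarith

/-- Lemma 2.1 for the SABRA model: `B : V_{α₁} × V_{α₂} → V_{-α₃}` is bounded whenever
`α₁ + α₂ + α₃ ≥ 1/2`. -/
theorem stmt1 (k0 lam a b : ℝ) (hk0 : 0 < k0) (hlam : 1 < lam)
    (α₁ α₂ α₃ : ℝ) (hα : (1:ℝ)/2 ≤ α₁ + α₂ + α₃) :
    ∃ c : ℝ, 0 < c ∧ ∀ u v : ℕ → ℂ,
      Summable (fun n : ℕ => (kk k0 lam (n+1)) ^ (4*α₁) * ‖u (n+1)‖^2) →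
      Summable (fun n : ℕ => (kk k0 lam (n+1)) ^ (4*α₂) * ‖v (n+1)‖^2) →
      Summable (fun n : ℕ =>
          (kk k0 lam (n+1)) ^ (4*(-α₃)) * ‖BSAB a b k0 lam u v (n+1)‖^2) ∧
      (∑' n : ℕ, (kk k0 lam (n+1)) ^ (4*(-α₃)) * ‖BSAB a b k0 lam u v (n+1)‖^2)
        ≤ c^2 * (∑' n : ℕ, (kk k0 lam (n+1)) ^ (4*α₁) * ‖u (n+1)‖^2)
             * (∑' n : ℕ, (kk k0 lam (n+1)) ^ (4*α₂) * ‖v (n+1)‖^2) := by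
  have hw := weightConst_pos hk0 hlam α₁ α₂ α₃
  refine ⟨√(16 * (a ^ 2 + b ^ 2 + 1) * weightConst k0 lam α₁ α₂ α₃), by positivity, ?_⟩
  rw [Real.sq_sqrt (by positivity)]
  intro u v hu hv
  have hshift (α : ℝ) (w : ℕ → ℂ) :
      (fun n : ℕ => kk k0 lam (n + 1) ^ (4 * α) * ‖w (n + 1)‖ ^ 2) =
        fun n => energyTerm k0 lam α w (n + 1) := by
    funext n
    simp [energyTerm, sh]
  rw [hshift] at hu hv
  rw [hshift α₁ u, hshift α₂ v]
  set U := ∑' n, energyTerm k0 lam α₁ u (n + 1)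
  have hU0 : 0 ≤ U := tsum_nonneg fun n => energyTerm_nonneg hk0 hlam α₁ u (n + 1)
  have hU (n : ℕ) : energyTerm k0 lam α₁ u n ≤ U := by
    cases n with
    | zero => exact (energyTerm_zero k0 lam α₁ u).trans_le hU0
    | succ m => exact hu.le_tsum m fun j _ => energyTerm_nonneg hk0 hlam α₁ u (j + 1)
  have hV := energyTerm_nonneg hk0 hlam α₂ v
  have hV0 := energyTerm_zero k0 lam α₂ v
  have hbound := BSAB_term_le hk0 hlam hα a b u v hU
  generalize energyTerm k0 lam α₂ v = V at *
  have hs : Summable V := (summable_nat_add_iff 1).1 hv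
  have hs3 : Summable fun n => V (n + 3) := (summable_nat_add_iff 3).2 hs
  have hs2 : Summable fun n => V (n + 2) := (summable_nat_add_iff 2).2 hs
  have hsp : Summable fun n => V (n - 1) := (summable_nat_add_iff 1).1 (by simpa using hs)
  have e1 : ∑' n, V (n + 1) = ∑' n, V n := by rw [hs.tsum_eq_zero_add, hV0, zero_add]
  have ep : ∑' n, V (n - 1) = ∑' n, V n := by rw [hsp.tsum_eq_zero_add]; simp [hV0]
  have e3 : ∑' n, V (n + 3) ≤ ∑' n, V n :=
    tsum_comp_le_tsum_of_inj hs hV (add_left_injective 3)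
  have e2 : ∑' n, V (n + 2) ≤ ∑' n, V n :=
    tsum_comp_le_tsum_of_inj hs hV (add_left_injective 2)
  have hmaj := (((hs3.add hs2).add hsp).add hs).mul_left
    (4 * (a ^ 2 + b ^ 2 + 1) * weightConst k0 lam α₁ α₂ α₃ * U)
  have hsum := Summable.of_nonneg_of_le
    (fun n => mul_nonneg (Real.rpow_nonneg (kk_pos hk0 hlam (n + 1)).le _) (sq_nonneg _))
    hbound hmaj
  refine ⟨hsum, (hsum.tsum_le_tsum hbound hmaj).trans ?_⟩
  rw [tsum_mul_left, ((hs3.add hs2).add hsp).tsum_add hs, (hs3.add hs2).tsum_add hsp,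
    hs3.tsum_add hs2, ep, e1]
  calc _ ≤ 4 * (a ^ 2 + b ^ 2 + 1) * weightConst k0 lam α₁ α₂ α₃ * U *
        (∑' n, V n + ∑' n, V n + ∑' n, V n + ∑' n, V n) := by gcongr
    _ = _ := by ring
end

section
/- (Skew-symmetry of the SABRA nonlinearity) For every u ∈ V_{1/2} and v, w ∈ V, the series defining (B(u,v), w)_V and (B(u,w), v)_V converge absolutely and Re (B(u,v), w)_V = − Re (B(u,w), v)_V. -/
open scoped ComplexConjugate

/-- A bounded multiple of a product of two square-summable sequences is summable. -/
theorem summable_mul_mul_conj {c v w : ℕ → ℂ} {C : ℝ} (hc : ∀ n, ‖c n‖ ≤ C)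
    (hv : Summable fun n => ‖v n‖ ^ 2) (hw : Summable fun n => ‖w n‖ ^ 2) :
    Summable fun n => c n * v n * conj (w n) := by
  refine Summable.of_norm_bounded ((hv.add hw).mul_left C) fun n => ?_
  have h : ‖v n‖ * ‖w n‖ ≤ ‖v n‖ ^ 2 + ‖w n‖ ^ 2 := by
    nlinarith [sq_nonneg (‖v n‖ - ‖w n‖), sq_nonneg (‖v n‖ + ‖w n‖)]
  rw [norm_mul, norm_mul, RCLike.norm_conj, mul_assoc]
  exact mul_le_mul (hc n) h (by positivity) ((norm_nonneg _).trans (hc n))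

/-- The interactions weighted by `a` in `(B(u,v),w)`, up to conjugation and exchange of
`v` and `w`. -/
noncomputable def aInteraction (a k0 lam : ℝ) (u v w : ℕ → ℂ) (n : ℕ) : ℂ :=
  Complex.I * a * (kk k0 lam (n + 2) : ℝ) * conj (u (n + 2)) * v (n + 3) * conj (w (n + 1))

/-- The interactions weighted by `b` in `(B(u,v),w)`, up to conjugation and exchange of
`v` and `w`. -/
noncomputable def bInteraction (b k0 lam : ℝ) (u v w : ℕ → ℂ) (n : ℕ) : ℂ :=
  Complex.I * b * (kk k0 lam (n + 2) : ℝ) * conj (u (n + 1)) * v (n + 3) * conj (w (n + 2))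

theorem exists_kk_mul_norm_le {k0 lam : ℝ} {u : ℕ → ℂ}
    (hu : Summable fun n : ℕ => (kk k0 lam (n + 1)) ^ 2 * ‖u (n + 1)‖ ^ 2) :
    ∃ C, ∀ n, |kk k0 lam (n + 1)| * ‖u (n + 1)‖ ≤ C := by
  refine ⟨√(∑' n : ℕ, (kk k0 lam (n + 1)) ^ 2 * ‖u (n + 1)‖ ^ 2), fun n => ?_⟩
  apply Real.le_sqrt_of_sq_le
  rw [mul_pow, sq_abs]
  exact hu.le_tsum n fun _ _ => by positivity

theorem summable_aInteraction {a k0 lam : ℝ} {u v w : ℕ → ℂ}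
    (hu : Summable fun n : ℕ => (kk k0 lam (n + 1)) ^ 2 * ‖u (n + 1)‖ ^ 2)
    (hv : Summable fun n : ℕ => ‖v (n + 1)‖ ^ 2) (hw : Summable fun n : ℕ => ‖w (n + 1)‖ ^ 2) :
    Summable (aInteraction a k0 lam u v w) := by
  obtain ⟨C, hC⟩ := exists_kk_mul_norm_le hu
  refine summable_mul_mul_conj (C := |a| * C) (fun n => ?_)
    ((summable_nat_add_iff 2).2 hv) hw
  simpa [mul_assoc] using mul_le_mul_of_nonneg_left (hC (n + 1)) (abs_nonneg a)

theorem summable_bInteraction {b k0 lam : ℝ} {u v w : ℕ → ℂ}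
    (hu : Summable fun n : ℕ => (kk k0 lam (n + 1)) ^ 2 * ‖u (n + 1)‖ ^ 2)
    (hv : Summable fun n : ℕ => ‖v (n + 1)‖ ^ 2) (hw : Summable fun n : ℕ => ‖w (n + 1)‖ ^ 2) :
    Summable (bInteraction b k0 lam u v w) := by
  obtain ⟨C, hC⟩ := exists_kk_mul_norm_le hu
  refine summable_mul_mul_conj (C := |b| * |lam| * C) (fun n => ?_)
    ((summable_nat_add_iff 2).2 hv) ((summable_nat_add_iff 1).2 hw)
  have hk : kk k0 lam (n + 2) = lam * kk k0 lam (n + 1) := by simp only [kk]; ring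
  rw [hk]
  simpa [mul_assoc] using
    mul_le_mul_of_nonneg_left (hC n) (mul_nonneg (abs_nonneg b) (abs_nonneg lam))

/-- The series `(B(u,v),w)` as a part and minus the conjugate of the part with `v` and `w`
exchanged. -/
theorem hasSum_BSAB {a b k0 lam : ℝ} {u v w : ℕ → ℂ}
    (hu : Summable fun n : ℕ => (kk k0 lam (n + 1)) ^ 2 * ‖u (n + 1)‖ ^ 2)
    (hv : Summable fun n : ℕ => ‖v (n + 1)‖ ^ 2) (hw : Summable fun n : ℕ => ‖w (n + 1)‖ ^ 2) :
    HasSum (fun n : ℕ => BSAB a b k0 lam u v (n + 1) * conj (w (n + 1)))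
      (∑' n, aInteraction a k0 lam u v w n + ∑' n, bInteraction b k0 lam u v w n
        - conj (∑' n, aInteraction a k0 lam u w v n)
        - conj (∑' n, bInteraction b k0 lam u w v n)) := by
  have h₁ := (summable_aInteraction (a := a) hu hv hw).hasSum
  have h₂ : HasSum (fun n : ℕ => Complex.I * b * (kk k0 lam (n + 1) : ℝ) * conj (sh u n) *
      v (n + 2) * conj (w (n + 1))) (∑' n, bInteraction b k0 lam u v w n) := by
    have := (summable_bInteraction (b := b) hu hv hw).hasSum
    rw [← hasSum_nat_add_iff' 1]
    convert this using 1
    · rfl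
    · simp only [sh, Nat.add_eq_zero_iff, one_ne_zero, and_false, if_false]
      rfl
    · simp [sh]
  have h₃ : HasSum (fun n : ℕ => Complex.I * a * (kk k0 lam n : ℝ) * sh u n *
      sh v (n - 1) * conj (w (n + 1))) (-conj (∑' n, aInteraction a k0 lam u w v n)) := by
    have := (Complex.hasSum_conj'.2 (summable_aInteraction (a := a) hu hw hv).hasSum).neg
    rw [← hasSum_nat_add_iff' 2]
    convert this using 1
    · funext n
      simp [sh, aInteraction, add_assoc]
      ring
    · simp [sh, Finset.sum_range_succ]
  have h₄ : HasSum (fun n : ℕ => Complex.I * b * (kk k0 lam n : ℝ) * sh u (n - 1) *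
      sh v n * conj (w (n + 1))) (-conj (∑' n, bInteraction b k0 lam u w v n)) := by
    have := (Complex.hasSum_conj'.2 (summable_bInteraction (b := b) hu hw hv).hasSum).neg
    rw [← hasSum_nat_add_iff' 2]
    convert this using 1
    · funext n
      simp [sh, bInteraction, add_assoc]
      ring
    · simp [sh, Finset.sum_range_succ]
  convert ((h₁.add h₂).add h₃).add h₄ using 1
  · funext n
    have hn : n + 1 - 2 = n - 1 := by omega
    simp only [BSAB, bSAB, aInteraction, hn, Nat.add_sub_cancel]
    simp only [sh, Nat.add_eq_zero_iff, OfNat.ofNat_ne_zero, and_false, if_false, add_assoc,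
      Nat.reduceAdd]
    ring
  · ring

/-- Skew-symmetry of the SABRA nonlinearity: for `u ∈ V_{1/2}` and `v, w ∈ V`, the series
defining `(B(u,v),w)_V` and `(B(u,w),v)_V` converge absolutely and
`Re (B(u,v),w)_V = - Re (B(u,w),v)_V`. -/
theorem stmt5 (k0 lam a b : ℝ) (hk0 : 0 < k0) (hlam : 1 < lam)
    (u v w : ℕ → ℂ)
    (hu : Summable (fun n : ℕ => (kk k0 lam (n+1))^2 * ‖u (n+1)‖^2))
    (hv : Summable (fun n : ℕ => ‖v (n+1)‖^2))
    (hw : Summable (fun n : ℕ => ‖w (n+1)‖^2)) :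
    Summable (fun n : ℕ => ‖BSAB a b k0 lam u v (n+1) * conj (w (n+1))‖) ∧
    Summable (fun n : ℕ => ‖BSAB a b k0 lam u w (n+1) * conj (v (n+1))‖) ∧
    (∑' n : ℕ, BSAB a b k0 lam u v (n+1) * conj (w (n+1))).re
      = - (∑' n : ℕ, BSAB a b k0 lam u w (n+1) * conj (v (n+1))).re := by
  have hvw := hasSum_BSAB (a := a) (b := b) hu hv hw
  have hwv := hasSum_BSAB (a := a) (b := b) hu hw hv
  refine ⟨hvw.summable.norm, hwv.summable.norm, ?_⟩
  rw [hvw.tsum_eq, hwv.tsum_eq]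
  simp only [Complex.add_re, Complex.sub_re, Complex.conj_re]
  ring
end
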